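/- Let P_8^+ be the subset of P_8 consisting of those vectors in which the entry +1 appears an even number of times, so #P_8^+ = 64. Then for every symmetric 8×8 complex matrix A with zero diagonal, 2^9·trace(A^3) = Σ_{v ∈ P_8^+} (trace((v·vᵀ − I_8)·A))^3. In particular, the symmetric rank of sM^Z_8 is at most 64. -/

import Mathlib

open Filter Matrix

/-- Symmetric (Waring) rank of a cubic polynomial: the smallest `r` such that
`P = ℓ₁³ + ⋯ + ℓᵣ³` for linear forms `ℓᵢ`. -/
noncomputable def symRank {W : Type*} [AddCommGroup W] [Module ℂ W]
    (P : W → ℂ) : ℕ :=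
  sInf {r : ℕ | ∃ ℓ : Fin r → (W →ₗ[ℂ] ℂ), ∀ a, P a = ∑ i, (ℓ i a) ^ 3}

/-- The space `Z_n` of symmetric n×n complex matrices with zero diagonal. -/
noncomputable def zeroDiagSym (n : ℕ) : Submodule ℂ (Matrix (Fin n) (Fin n) ℂ) where
  carrier := {A | Aᵀ = A ∧ ∀ i, A i i = 0}
  add_mem' := by
    intro a b ha hb
    refine ⟨by rw [Matrix.transpose_add, ha.1, hb.1], fun i => ?_⟩
    simp [ha.2 i, hb.2 i]
  zero_mem' := by simp
  smul_mem' := by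
    intro c A hA
    refine ⟨by rw [Matrix.transpose_smul, hA.1], fun i => ?_⟩
    simp [hA.2 i]

/-- `sM^Z_n`: the restriction of `sM_n` to symmetric matrices with zero diagonal. -/
noncomputable def sMZ (n : ℕ) : zeroDiagSym n → ℂ :=
  fun A => ((A : Matrix (Fin n) (Fin n) ℂ) ^ 3).trace

/-- The ±1 vector associated to a sign pattern `ε`, with `+1` where `ε` is `true`. -/
noncomputable def pmVec {n : ℕ} (ε : Fin n → Bool) : Fin n → ℂ :=
  fun i => if ε i then 1 else -1

/-- The set `P₈⁺` of sign patterns with first coordinate `+1` and an even number of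
`+1` entries. -/
noncomputable def P8plus : Finset (Fin 8 → Bool) :=
  Finset.univ.filter (fun ε : Fin 8 → Bool =>
    ε 0 = true ∧ Even (Finset.univ.filter (fun i => ε i = true)).card)


/-- Integer version of the character sums, checked by evaluation. -/
theorem char_sum_int : ∀ S : Finset (Fin 8), Even S.card → S ≠ ∅ → S ≠ Finset.univ →
    ∑ ε ∈ Finset.univ.filter (fun ε : Fin 8 → Bool =>
    ε 0 = true ∧ Even (Finset.univ.filter (fun i => ε i = true)).card),
      ∏ i ∈ S, (if ε i then (1 : ℤ) else -1) = 0 := by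
  decide +kernel

theorem card_P8plus : P8plus.card = 64 := by
  unfold P8plus
  decide +kernel

theorem char_sum (S : Finset (Fin 8)) (h : Even S.card) (h0 : S.card ≠ 0) (h1 : S.card < 8) :
    ∑ ε ∈ P8plus, ∏ i ∈ S, pmVec ε i = 0 := by
  have := char_sum_int S h (by rintro rfl; simp at h0) (by rintro rfl; simp at h1)
  have h2 := congrArg (Int.cast : ℤ → ℂ) this
  push_cast at h2
  simpa [P8plus, pmVec] using h2

theorem sq1 (ε : Fin 8 → Bool) (i : Fin 8) : pmVec ε i * pmVec ε i = 1 := by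
  unfold pmVec; split_ifs <;> norm_num

theorem E2 {a b : Fin 8} (h : a ≠ b) : ∑ ε ∈ P8plus, pmVec ε a * pmVec ε b = 0 := by
  have hc : ({a, b} : Finset (Fin 8)).card = 2 := Finset.card_pair h
  have := char_sum {a, b} (by rw [hc]; decide) (by omega) (by omega)
  simpa [Finset.prod_pair h] using this

theorem E4 {a b c d : Fin 8} (h1 : a ≠ b) (h2 : a ≠ c) (h3 : a ≠ d) (h4 : b ≠ c) (h5 : b ≠ d)
    (h6 : c ≠ d) :
    ∑ ε ∈ P8plus, pmVec ε a * pmVec ε b * pmVec ε c * pmVec ε d = 0 := by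
  have hc : ({a, b, c, d} : Finset (Fin 8)).card = 4 := by simp [*]
  have := char_sum {a, b, c, d} (by rw [hc]; decide) (by omega) (by omega)
  simpa [Finset.prod_insert, *, mul_assoc] using this

theorem E6 {a b c d e f : Fin 8} (h1 : a ≠ b) (h2 : a ≠ c) (h3 : a ≠ d) (h4 : b ≠ c) (h5 : b ≠ d)
    (h6 : c ≠ d) (ha : a ≠ e) (hb : b ≠ e) (hc : c ≠ e) (hd : d ≠ e)
    (ha' : a ≠ f) (hb' : b ≠ f) (hc' : c ≠ f) (hd' : d ≠ f) (hef : e ≠ f) :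
    ∑ ε ∈ P8plus, pmVec ε a * pmVec ε b * pmVec ε c * pmVec ε d * pmVec ε e * pmVec ε f = 0 := by
  have hk : ({a, b, c, d, e, f} : Finset (Fin 8)).card = 6 := by simp [*]
  have := char_sum {a, b, c, d, e, f} (by rw [hk]; decide) (by omega) (by omega)
  simpa [Finset.prod_insert, *, mul_assoc] using this

/-- Kronecker delta. -/
noncomputable def dl (a b : Fin 8) : ℂ := if a = b then 1 else 0

theorem sum_one : ∑ ε ∈ P8plus, (1 : ℂ) = 64 := by simp [card_P8plus]

theorem G4 {a b m n : Fin 8} (h : a ≠ b) (h' : m ≠ n) :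
    ∑ ε ∈ P8plus, pmVec ε a * pmVec ε b * pmVec ε m * pmVec ε n
      = 64 * (dl a m * dl b n + dl a n * dl b m) := by
  by_cases h1 : a = m
  · subst h1
    rw [Finset.sum_congr rfl (g := fun ε => pmVec ε b * pmVec ε n)
      (fun ε _ => by linear_combination (pmVec ε b * pmVec ε n) * sq1 ε a)]
    by_cases h2 : b = n
    · subst h2
      simp [sq1, dl, h, h.symm, card_P8plus]
    · simp [E2 h2, dl, h2, h']
  by_cases h2 : a = n
  · subst h2
    rw [Finset.sum_congr rfl (g := fun ε => pmVec ε b * pmVec ε m)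
      (fun ε _ => by linear_combination (pmVec ε b * pmVec ε m) * sq1 ε a)]
    by_cases h2 : b = m
    · subst h2
      simp [sq1, dl, h, card_P8plus]
    · simp [E2 h2, dl, h2, h1]
  by_cases h3 : b = m
  · subst h3
    rw [Finset.sum_congr rfl (g := fun ε => pmVec ε a * pmVec ε n)
      (fun ε _ => by linear_combination (pmVec ε a * pmVec ε n) * sq1 ε b)]
    simp [E2 h2, dl, h1, h2]
  by_cases h4 : b = n
  · subst h4
    rw [Finset.sum_congr rfl (g := fun ε => pmVec ε a * pmVec ε m)
      (fun ε _ => by linear_combination (pmVec ε a * pmVec ε m) * sq1 ε b)]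
    simp [E2 h1, dl, h1, h2]
  rw [E4 h h1 h2 h3 h4 h']
  simp [dl, h1, h2]

/-- two edges sharing the vertex `i`, third edge arbitrary -/
theorem G6s {i j l m n : Fin 8} (h : i ≠ j) (h' : i ≠ l) (h'' : m ≠ n) :
    ∑ ε ∈ P8plus, pmVec ε i * pmVec ε j * pmVec ε i * pmVec ε l * pmVec ε m * pmVec ε n
      = 64 * (dl j m * dl l n + dl j n * dl l m) := by
  rw [Finset.sum_congr rfl (g := fun ε => pmVec ε j * pmVec ε l * pmVec ε m * pmVec ε n)
      (fun ε _ => by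
        linear_combination (pmVec ε j * pmVec ε l * pmVec ε m * pmVec ε n) * sq1 ε i)]
  by_cases hjl : j = l
  · subst hjl
    rw [Finset.sum_congr rfl (g := fun ε => pmVec ε m * pmVec ε n)
      (fun ε _ => by linear_combination (pmVec ε m * pmVec ε n) * sq1 ε j)]
    rw [E2 h'']
    unfold dl
    split_ifs <;> simp_all
  · exact G4 hjl h''

/-- two disjoint edges, third edge with an end on the first one -/
theorem G6d {i j k l n : Fin 8} (h : i ≠ j) (h1 : k ≠ l) (h2 : i ≠ k) (h3 : i ≠ l)
    (h4 : j ≠ k) (h5 : j ≠ l) (h6 : i ≠ n) :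
    ∑ ε ∈ P8plus, pmVec ε i * pmVec ε j * pmVec ε k * pmVec ε l * pmVec ε i * pmVec ε n = 0 := by
  rw [Finset.sum_congr rfl (g := fun ε => pmVec ε j * pmVec ε n * pmVec ε k * pmVec ε l)
      (fun ε _ => by
        linear_combination (pmVec ε j * pmVec ε n * pmVec ε k * pmVec ε l) * sq1 ε i)]
  by_cases hjn : j = n
  · subst hjn
    rw [Finset.sum_congr rfl (g := fun ε => pmVec ε k * pmVec ε l)
      (fun ε _ => by linear_combination (pmVec ε k * pmVec ε l) * sq1 ε j)]
    exact E2 h1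
  · rw [G4 hjn h1]
    simp [dl, h4, h5]

theorem dl_self (a : Fin 8) : dl a a = 1 := by simp [dl]

theorem dl_ne {a b : Fin 8} (h : a ≠ b) : dl a b = 0 := by simp [dl, h]

theorem dl_mul (a : Fin 8) {m n : Fin 8} (h : m ≠ n) : dl a m * dl a n = 0 := by
  by_cases h1 : a = m
  · subst h1; simp [dl, h]
  · simp [dl, h1]

theorem G6 {i j k l m n : Fin 8} (h : i ≠ j) (h' : k ≠ l) (h'' : m ≠ n) :
    ∑ ε ∈ P8plus, pmVec ε i * pmVec ε j * pmVec ε k * pmVec ε l * pmVec ε m * pmVec ε n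
      = 64 * (dl i k * (dl j m * dl l n + dl j n * dl l m)
        + dl i l * (dl j m * dl k n + dl j n * dl k m)
        + dl j k * (dl i m * dl l n + dl i n * dl l m)
        + dl j l * (dl i m * dl k n + dl i n * dl k m)) := by
  have comm : ∀ f g : (Fin 8 → Bool) → ℂ, (∀ ε, f ε = g ε) →
      ∑ ε ∈ P8plus, f ε = ∑ ε ∈ P8plus, g ε := fun f g hh => Finset.sum_congr rfl fun ε _ => hh ε
  by_cases h1 : i = k
  · subst h1
    rw [G6s h h' h'']
    rw [dl_self, dl_ne h', dl_ne h.symm, dl_mul i h'', dl_mul i h''.symm]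
    ring
  by_cases h2 : i = l
  · subst h2
    refine (comm _ _ (fun ε => by ring)).trans ((G6s h h'.symm h'').trans ?_)
    rw [dl_self, dl_ne h1, dl_ne h.symm, dl_mul i h'', dl_mul i h''.symm]
    ring
  by_cases h3 : j = k
  · subst h3
    refine (comm _ _ (fun ε => by ring)).trans ((G6s h.symm h' h'').trans ?_)
    rw [dl_self, dl_ne h, dl_ne h', dl_mul j h'', dl_mul j h''.symm]
    ring
  by_cases h4 : j = l
  · subst h4
    refine (comm _ _ (fun ε => by ring)).trans ((G6s h.symm h'.symm h'').trans ?_)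
    rw [dl_self, dl_ne h, dl_ne h3, dl_mul j h'', dl_mul j h''.symm]
    ring
  have hz : dl i k = 0 ∧ dl i l = 0 ∧ dl j k = 0 ∧ dl j l = 0 := by simp [dl, *]
  obtain ⟨z1, z2, z3, z4⟩ := hz
  rw [z1, z2, z3, z4]
  simp only [zero_mul, add_zero, mul_zero]
  by_cases k1 : i = m
  · subst k1
    exact G6d h h' h1 h2 h3 h4 h''
  by_cases k2 : j = m
  · subst k2
    exact (comm _ _ (fun ε => by ring)).trans (G6d h.symm h' h3 h4 h1 h2 h'')
  by_cases k3 : k = m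
  · subst k3
    exact (comm _ _ (fun ε => by ring)).trans
      (G6d h' h (Ne.symm h1) (Ne.symm h3) (Ne.symm h2) (Ne.symm h4) h'')
  by_cases k4 : l = m
  · subst k4
    exact (comm _ _ (fun ε => by ring)).trans
      (G6d h'.symm h (Ne.symm h2) (Ne.symm h4) (Ne.symm h1) (Ne.symm h3) h'')
  by_cases l1 : i = n
  · subst l1
    exact (comm _ _ (fun ε => by ring)).trans (G6d h h' h1 h2 h3 h4 h''.symm)
  by_cases l2 : j = n
  · subst l2
    exact (comm _ _ (fun ε => by ring)).trans (G6d h.symm h' h3 h4 h1 h2 h''.symm)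
  by_cases l3 : k = n
  · subst l3
    exact (comm _ _ (fun ε => by ring)).trans
      (G6d h' h (Ne.symm h1) (Ne.symm h3) (Ne.symm h2) (Ne.symm h4) h''.symm)
  by_cases l4 : l = n
  · subst l4
    exact (comm _ _ (fun ε => by ring)).trans
      (G6d h'.symm h (Ne.symm h2) (Ne.symm h4) (Ne.symm h1) (Ne.symm h3) h''.symm)
  exact E6 h h1 h2 h3 h4 h' k1 k2 k3 k4 l1 l2 l3 l4 h''

theorem trace_form (A : Matrix (Fin 8) (Fin 8) ℂ) (hd : ∀ i, A i i = 0) (ε : Fin 8 → Bool) :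
    ((Matrix.vecMulVec (pmVec ε) (pmVec ε) - 1) * A).trace
      = ∑ i, ∑ j, A i j * (pmVec ε i * pmVec ε j) := by
  have ht : A.trace = 0 := by simp [Matrix.trace, hd]
  rw [sub_mul, one_mul, Matrix.trace_sub, ht, sub_zero, Finset.sum_comm]
  simp only [Matrix.trace, Matrix.diag, Matrix.mul_apply, Matrix.vecMulVec_apply]
  exact Finset.sum_congr rfl fun i _ => Finset.sum_congr rfl fun j _ => by ring

theorem cube_expand (F : Fin 8 → Fin 8 → ℂ) : (∑ i, ∑ j, F i j) ^ 3
    = ∑ i, ∑ j, ∑ k, ∑ l, ∑ m, ∑ n, F i j * F k l * F m n := by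
  simp only [← Finset.mul_sum, ← Finset.sum_mul]
  ring

theorem trace_cube (A : Matrix (Fin 8) (Fin 8) ℂ) :
    (A ^ 3).trace = ∑ i, ∑ j, ∑ k, A i j * A j k * A k i := by
  simp only [pow_succ, pow_zero, one_mul, Matrix.trace, Matrix.diag, Matrix.mul_apply,
    Finset.sum_mul]
  exact Finset.sum_congr rfl fun i _ => Finset.sum_comm

theorem main_identity (A : Matrix (Fin 8) (Fin 8) ℂ) (hs : Aᵀ = A) (hd : ∀ i, A i i = 0) :
    (2 : ℂ) ^ 9 * (A ^ 3).trace =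
        ∑ ε ∈ P8plus,
          ((Matrix.vecMulVec (pmVec ε) (pmVec ε) - 1) * A).trace ^ 3 := by
  have sy : ∀ i j, A j i = A i j := fun i j => congrFun (congrFun hs i) j
  have step : ∀ i j k l m n, ∑ ε ∈ P8plus, A i j * (pmVec ε i * pmVec ε j) *
      (A k l * (pmVec ε k * pmVec ε l)) * (A m n * (pmVec ε m * pmVec ε n))
      = A i j * A k l * A m n * (64 * (dl i k * (dl j m * dl l n + dl j n * dl l m)
        + dl i l * (dl j m * dl k n + dl j n * dl k m)
        + dl j k * (dl i m * dl l n + dl i n * dl l m)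
        + dl j l * (dl i m * dl k n + dl i n * dl k m))) := by
    intro i j k l m n
    by_cases h : i = j
    · subst h; simp [hd]
    by_cases h' : k = l
    · subst h'; simp [hd]
    by_cases h'' : m = n
    · subst h''; simp [hd]
    rw [← G6 h h' h'', Finset.mul_sum]
    exact Finset.sum_congr rfl fun ε _ => by ring
  simp only [trace_form A hd, cube_expand]
  have sw : ∀ f : (Fin 8 → Bool) → Fin 8 → ℂ,
      ∑ ε ∈ P8plus, ∑ i, f ε i = ∑ i, ∑ ε ∈ P8plus, f ε i := fun f => Finset.sum_comm
  simp only [sw, step]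
  have inner : ∀ i j k l, ∑ m, ∑ n, A i j * A k l * A m n *
      (64 * (dl i k * (dl j m * dl l n + dl j n * dl l m)
        + dl i l * (dl j m * dl k n + dl j n * dl k m)
        + dl j k * (dl i m * dl l n + dl i n * dl l m)
        + dl j l * (dl i m * dl k n + dl i n * dl k m)))
      = 128 * (dl i k * (A i j * A k l * A j l) + dl i l * (A i j * A k l * A j k)
        + dl j k * (A i j * A k l * A i l) + dl j l * (A i j * A k l * A i k)) := by
    intro i j k l
    have pr : ∀ a b, ∑ m, ∑ n, A m n * (dl a m * dl b n + dl a n * dl b m) = 2 * A a b := by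
      intro a b
      simp [dl, mul_add, Finset.sum_add_distrib, sy a b]
      ring
    have e : ∀ m n, A i j * A k l * A m n *
      (64 * (dl i k * (dl j m * dl l n + dl j n * dl l m)
        + dl i l * (dl j m * dl k n + dl j n * dl k m)
        + dl j k * (dl i m * dl l n + dl i n * dl l m)
        + dl j l * (dl i m * dl k n + dl i n * dl k m))) =
        (64 * A i j * A k l * dl i k) * (A m n * (dl j m * dl l n + dl j n * dl l m))
        + (64 * A i j * A k l * dl i l) * (A m n * (dl j m * dl k n + dl j n * dl k m))
        + (64 * A i j * A k l * dl j k) * (A m n * (dl i m * dl l n + dl i n * dl l m))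
        + (64 * A i j * A k l * dl j l) * (A m n * (dl i m * dl k n + dl i n * dl k m)) := by
      intro m n; ring
    simp only [e, Finset.sum_add_distrib, ← Finset.mul_sum, pr]
    ring
  simp only [inner, ← Finset.mul_sum, Finset.sum_add_distrib]
  have t1 : ∑ i, ∑ j, ∑ k, ∑ l, dl i k * (A i j * A k l * A j l) = (A ^ 3).trace := by
    rw [trace_cube]
    simp only [← Finset.mul_sum]
    simp only [dl, ite_mul, one_mul, zero_mul, Finset.sum_ite_eq, Finset.mem_univ, if_true]
    exact Finset.sum_congr rfl fun i _ => Finset.sum_congr rfl fun j _ =>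
      Finset.sum_congr rfl fun k _ => by rw [sy i k]; ring
  have t2 : ∑ i, ∑ j, ∑ k, ∑ l, dl i l * (A i j * A k l * A j k) = (A ^ 3).trace := by
    rw [trace_cube]
    simp only [dl, ite_mul, one_mul, zero_mul, Finset.sum_ite_eq, Finset.mem_univ, if_true]
    exact Finset.sum_congr rfl fun i _ => Finset.sum_congr rfl fun j _ =>
      Finset.sum_congr rfl fun k _ => by ring
  have t3 : ∑ i, ∑ j, ∑ k, ∑ l, dl j k * (A i j * A k l * A i l) = (A ^ 3).trace := by
    rw [trace_cube]
    simp only [← Finset.mul_sum]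
    simp only [dl, ite_mul, one_mul, zero_mul, Finset.sum_ite_eq, Finset.mem_univ, if_true]
    exact Finset.sum_congr rfl fun i _ => Finset.sum_congr rfl fun j _ =>
      Finset.sum_congr rfl fun k _ => by rw [sy i k]
  have t4 : ∑ i, ∑ j, ∑ k, ∑ l, dl j l * (A i j * A k l * A i k) = (A ^ 3).trace := by
    rw [trace_cube]
    simp only [dl, ite_mul, one_mul, zero_mul, Finset.sum_ite_eq, Finset.mem_univ, if_true]
    exact Finset.sum_congr rfl fun i _ => Finset.sum_congr rfl fun j _ =>
      Finset.sum_congr rfl fun k _ => by rw [sy i k, sy j k]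
  simp only [← Finset.mul_sum] at t1 t3
  rw [t1, t2, t3, t4]
  ring

/-- The linear form attached to a sign pattern, scaled by `1/8`. -/
noncomputable def linForm (ε : Fin 8 → Bool) : zeroDiagSym 8 →ₗ[ℂ] ℂ :=
  (1 / 8 : ℂ) • ((Matrix.traceLinearMap (Fin 8) ℂ ℂ).comp
    ((LinearMap.mulLeft ℂ (Matrix.vecMulVec (pmVec ε) (pmVec ε) - 1)).comp
      (zeroDiagSym 8).subtype))

theorem rank_bound : symRank (sMZ 8) ≤ 64 := by
  apply Nat.sInf_le
  let e := P8plus.equivFinOfCardEq card_P8plus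
  refine ⟨fun i => linForm (e.symm i), fun a => ?_⟩
  have h := main_identity a.1 a.2.1 a.2.2
  rw [Equiv.sum_comp e.symm (fun x : P8plus => (linForm x a) ^ 3),
    Finset.sum_coe_sort P8plus (fun ε => (linForm ε a) ^ 3)]
  have h2 : ∀ ε, (linForm ε a) ^ 3 = (1 / 512 : ℂ) *
      ((Matrix.vecMulVec (pmVec ε) (pmVec ε) - 1) * a.1).trace ^ 3 := by
    intro ε
    simp only [linForm, LinearMap.smul_apply, LinearMap.comp_apply, LinearMap.mulLeft_apply,
      Matrix.traceLinearMap_apply, Submodule.subtype_apply, smul_eq_mul]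
    ring
  simp only [h2, ← Finset.mul_sum, ← h, sMZ]
  ring

theorem waring_decomposition_sMZ8 :
    P8plus.card = 64 ∧
    (∀ A : Matrix (Fin 8) (Fin 8) ℂ, Aᵀ = A → (∀ i, A i i = 0) →
      (2 : ℂ) ^ 9 * (A ^ 3).trace =
        ∑ ε ∈ P8plus,
          ((Matrix.vecMulVec (pmVec ε) (pmVec ε) - 1) * A).trace ^ 3) ∧
    symRank (sMZ 8) ≤ 64 := by
  exact ⟨card_P8plus, main_identity, rank_bound⟩
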